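/- arXiv:math-ph/0701073 — 3 statements merged into one kernel-verified Lean document; each statement's English description precedes it below -/
import Mathlib

section
/- Let H be a real Hilbert space, H₁ ⊆ H a linear subspace, and A, B : H₁ → H linear maps. Fix λ₀ ∈ ℝ, a function β : ℝ → ℝ, and vectors e, e* ∈ H₁ such that: (i) (A + λ₀B)e = β(λ₀)e; (ii) ⟨(A + λ₀B)x, e*⟩ = β(λ₀)⟨x, e*⟩ for all x ∈ H₁ (i.e. e* is a weak eigenvector of the adjoint problem with the same eigenvalue); (iii) ⟨e, e*⟩ = 1; (iv) there exist δ₀ > 0 and a family (v_δ)_{0<|δ|<δ₀} ⊆ H₁ such that (A + (λ₀+δ)B)(e + v_δ) = β(λ₀+δ)(e + v_δ) for all 0 < |δ| < δ₀, and ‖v_δ‖_H → 0 and ‖B v_δ‖_H → 0 as δ → 0. Then β is differentiable at λ₀ and β'(λ₀) = ⟨B e, e*⟩. -/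
open Filter Topology RealInnerProductSpace

/-- Theorem 4.3: differentiation formula for a simple eigenvalue of the family
`L_λ = A + λ B` on a real Hilbert space. -/
theorem eigenvalue_derivative_formula
    {H : Type*} [NormedAddCommGroup H] [InnerProductSpace ℝ H]
    (H₁ : Submodule ℝ H) (A B : H₁ →ₗ[ℝ] H)
    (lam0 : ℝ) (β : ℝ → ℝ) (e estar : H₁)
    (hi : A e + lam0 • B e = β lam0 • (e : H))
    (hii : ∀ x : H₁, ⟪A x + lam0 • B x, (estar : H)⟫ = β lam0 * ⟪(x : H), (estar : H)⟫)
    (hiii : ⟪(e : H), (estar : H)⟫ = 1)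
    (hiv : ∃ δ₀ > (0 : ℝ), ∃ v : ℝ → H₁,
      (∀ δ : ℝ, 0 < |δ| → |δ| < δ₀ →
        A (e + v δ) + (lam0 + δ) • B (e + v δ) = β (lam0 + δ) • ((e : H) + (v δ : H))) ∧
      Tendsto (fun δ : ℝ => ‖((v δ : H))‖) (𝓝[≠] 0) (𝓝 0) ∧
      Tendsto (fun δ : ℝ => ‖B (v δ)‖) (𝓝[≠] 0) (𝓝 0)) :
    HasDerivAt β ⟪B e, (estar : H)⟫ lam0 := by
  obtain ⟨δ₀, hδ₀, v, hv, hv0, hBv0⟩ := hiv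
  have hnum : Tendsto (fun δ => ⟪B (e + v δ), (estar : H)⟫) (𝓝[≠] 0)
      (𝓝 ⟪B e, (estar : H)⟫) := by
    have h := ((tendsto_zero_iff_norm_tendsto_zero.mpr hBv0).const_add (B e)).inner (𝕜 := ℝ)
      (tendsto_const_nhds (x := (estar : H)))
    simpa only [map_add, add_zero] using h
  have hden : Tendsto (fun δ => ⟪(e : H) + (v δ : H), (estar : H)⟫) (𝓝[≠] 0) (𝓝 1) := by
    have h := ((tendsto_zero_iff_norm_tendsto_zero.mpr hv0).const_add (e : H)).inner (𝕜 := ℝ)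
      (tendsto_const_nhds (x := (estar : H)))
    simpa only [add_zero, hiii] using h
  rw [hasDerivAt_iff_tendsto_slope_zero]
  have hquot := hnum.div hden one_ne_zero
  rw [div_one] at hquot
  refine hquot.congr' ?_
  have hsmall : ∀ᶠ δ : ℝ in 𝓝[≠] 0, |δ| < δ₀ := by
    refine nhdsWithin_le_nhds ?_
    filter_upwards [Metric.ball_mem_nhds (0 : ℝ) hδ₀] with δ hδ
    simpa using hδ
  filter_upwards [hsmall, self_mem_nhdsWithin, hden.eventually_ne one_ne_zero]
    with δ hδ hδne hne
  have hδne : δ ≠ 0 := hδne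
  have heig := congrArg (fun x => ⟪x, (estar : H)⟫) (hv δ (abs_pos.mpr hδne) hδ)
  have hadj := hii (e + v δ)
  simp only [add_smul, ← add_assoc] at heig
  rw [inner_add_left, hadj, real_inner_smul_left, real_inner_smul_left,
    Submodule.coe_add] at heig
  simp only [Pi.div_apply, smul_eq_mul]
  field_simp
  linarith
end

section
/- Let a > 0 and λ₀ ≠ 0 be real numbers, and let R : ℝ → ℝ be six times differentiable and satisfy the sixth-order equation ((d²/dr² − a²)³ R)(r) = −a² λ₀² R(r) for all r ∈ ℝ. Define u_z(z,r) = (1/a) sin(az) R'(r), u_r(z,r) = −cos(az) R(r), u_θ(z,r) = −(1/(a²λ₀)) cos(az) ((d²/dr² − a²)² R)(r), and q(z,r) = −(1/a²) cos(az) ( R'''(r) − a² R'(r) ). Then, with Δ = ∂²/∂z² + ∂²/∂r², the following four equations hold at every point (z,r) ∈ ℝ²: (i) −Δu_z + ∂q/∂z = 0; (ii) −Δu_r + ∂q/∂r = λ₀ u_θ; (iii) −Δu_θ = λ₀ u_r; (iv) ∂u_z/∂z + ∂u_r/∂r = 0. -/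
theorem deriv_sin_const_mul (a : ℝ) :
    deriv (fun t => Real.sin (a * t)) = fun t => a * Real.cos (a * t) := by
  funext t
  have h := ((hasDerivAt_id t).const_mul a).sin
  simpa [mul_comm] using h.deriv

theorem deriv_cos_const_mul (a : ℝ) :
    deriv (fun t => Real.cos (a * t)) = fun t => -a * Real.sin (a * t) := by
  funext t
  have h := ((hasDerivAt_id t).const_mul a).cos
  simpa [mul_comm] using h.deriv

/-- The Laplacian of a separated function `c * g z * f r`, written as iterated derivatives. -/
theorem deriv_deriv_separated (c : ℝ) (g f : ℝ → ℝ) (z r : ℝ) :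
    deriv (deriv (fun t => c * g t * f r)) z + deriv (deriv (fun t => c * g z * f t)) r =
      c * (deriv (deriv g) z * f r + g z * deriv (deriv f) r) := by
  have h1 : (fun t => c * g t * f r) = fun t => (c * f r) * g t := by
    funext t; ring
  simp only [h1, deriv_const_mul_field']
  ring

/-- The separation-of-variables ansatz built from a solution `R` of
`(d²/dr² - a²)³ R = -a²λ₀² R` is an exact solution of the symmetric linearized
narrow-gap Taylor eigenvalue system (5.5) at `λ = λ₀`. -/
theorem taylor_eigenfunction_ansatz
    (a lam0 : ℝ) (ha : 0 < a) (hlam : lam0 ≠ 0)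
    (R : ℝ → ℝ) (hR : ∀ k < 6, Differentiable ℝ (iteratedDeriv k R))
    (D : (ℝ → ℝ) → (ℝ → ℝ))
    (hD : D = fun f r => deriv (deriv f) r - a ^ 2 * f r)
    (heq : ∀ r : ℝ, D (D (D R)) r = -(a ^ 2) * lam0 ^ 2 * R r)
    (uz ur uθ q : ℝ → ℝ → ℝ)
    (huz : uz = fun z r => (1 / a) * Real.sin (a * z) * deriv R r)
    (hur : ur = fun z r => -(Real.cos (a * z)) * R r)
    (huθ : uθ = fun z r => -(1 / (a ^ 2 * lam0)) * Real.cos (a * z) * D (D R) r)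
    (hq : q = fun z r => -(1 / a ^ 2) * Real.cos (a * z) *
      (deriv (deriv (deriv R)) r - a ^ 2 * deriv R r))
    (Δ : (ℝ → ℝ → ℝ) → ℝ → ℝ → ℝ)
    (hΔ : Δ = fun f z r => deriv (deriv (fun t => f t r)) z + deriv (deriv (fun t => f z t)) r) :
    ∀ z r : ℝ,
      (-Δ uz z r + deriv (fun t => q t r) z = 0) ∧
      (-Δ ur z r + deriv (fun t => q z t) r = lam0 * uθ z r) ∧
      (-Δ uθ z r = lam0 * ur z r) ∧
      (deriv (fun t => uz t r) z + deriv (fun t => ur z t) r = 0) := by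
  have h0 : Differentiable ℝ R := by simpa using hR 0 (by norm_num)
  have h1 : Differentiable ℝ (deriv R) := by simpa [iteratedDeriv_succ] using hR 1 (by norm_num)
  have h2 : Differentiable ℝ (deriv (deriv R)) := by
    simpa [iteratedDeriv_succ] using hR 2 (by norm_num)
  have h3 : Differentiable ℝ (deriv (deriv (deriv R))) := by
    simpa [iteratedDeriv_succ] using hR 3 (by norm_num)
  have hDD (r : ℝ) : D (D R) r =
      deriv (deriv (deriv (deriv R))) r - 2 * a ^ 2 * deriv (deriv R) r + a ^ 4 * R r := by
    have e1 : deriv (fun r => deriv (deriv R) r - a ^ 2 * R r) =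
        fun r => deriv (deriv (deriv R)) r - a ^ 2 * deriv R r := by
      funext r
      rw [deriv_fun_sub (h2 r) ((h0 r).const_mul _), deriv_const_mul_field]
    simp only [hD, e1]
    rw [deriv_fun_sub (h3 r) ((h1 r).const_mul _), deriv_const_mul_field]
    ring
  have ha' : a ≠ 0 := ha.ne'
  intro z r
  have hE : deriv (deriv (D (D R))) r = -(a ^ 2) * lam0 ^ 2 * R r + a ^ 2 * D (D R) r := by
    have h := heq r
    rw [show D (D (D R)) r = deriv (deriv (D (D R))) r - a ^ 2 * D (D R) r from
      congrFun (congrFun hD (D (D R))) r] at h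
    linarith
  have hc : deriv (deriv (fun t => Real.cos (a * t))) z = -a ^ 2 * Real.cos (a * z) := by
    rw [deriv_cos_const_mul, deriv_const_mul_field, deriv_sin_const_mul]; ring
  have hs : deriv (deriv (fun t => Real.sin (a * t))) z = -a ^ 2 * Real.sin (a * z) := by
    rw [deriv_sin_const_mul, deriv_const_mul_field, deriv_cos_const_mul]; ring
  have hqr : deriv (fun t => q z t) r = -(1 / a ^ 2) * Real.cos (a * z) *
      (deriv (deriv (deriv (deriv R))) r - a ^ 2 * deriv (deriv R) r) := by
    simp only [hq]
    rw [deriv_const_mul_field, deriv_fun_sub (h3 r) ((h1 r).const_mul _), deriv_const_mul_field]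
  have hqz : deriv (fun t => q t r) z = (1 / a) * Real.sin (a * z) *
      (deriv (deriv (deriv R)) r - a ^ 2 * deriv R r) := by
    simp only [hq]
    rw [deriv_mul_const_field, deriv_const_mul_field, deriv_cos_const_mul]
    field_simp
  have hΔz : Δ uz z r = (1 / a) * Real.sin (a * z) *
      (deriv (deriv (deriv R)) r - a ^ 2 * deriv R r) := by
    simp only [hΔ, huz]
    rw [deriv_deriv_separated (1 / a) (fun t => Real.sin (a * t)), hs]; ring
  have hΔr : Δ ur z r = -Real.cos (a * z) * (deriv (deriv R) r - a ^ 2 * R r) := by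
    have hur' : ur = fun z r => (-1) * Real.cos (a * z) * R r := by
      rw [hur]; funext z r; ring
    simp only [hΔ, hur']
    rw [deriv_deriv_separated (-1) (fun t => Real.cos (a * t)), hc]; ring
  have hΔθ : Δ uθ z r = lam0 * Real.cos (a * z) * R r := by
    simp only [hΔ, huθ]
    rw [deriv_deriv_separated (-(1 / (a ^ 2 * lam0))) (fun t => Real.cos (a * t)), hc, hE]
    field_simp
    ring
  refine ⟨?_, ?_, ?_, ?_⟩
  · rw [hΔz, hqz]; ring
  · rw [hΔr, hqr]
    simp only [huθ, hDD]
    field_simp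
    ring
  · rw [hΔθ]
    simp only [hur]
    ring
  · simp only [huz, hur]
    rw [deriv_mul_const_field, deriv_const_mul_field, deriv_const_mul_field, deriv_sin_const_mul]
    field_simp
    ring
end

section
/- Let L > 0, let K ≥ 1 be an integer, a = Kπ/L, λ₀ > 0, r₁ ∈ ℝ, and let R : ℝ → ℝ be four times continuously differentiable on [r₁, r₁+1] with R(r₁) = R(r₁+1) = 0 and R'(r₁) = R'(r₁+1) = 0, and suppose R is not identically zero on [r₁, r₁+1]. Define u_r(z,r) = −cos(az) R(r) and u_θ(z,r) = −(1/(a²λ₀)) cos(az) ( R''''(r) − 2a² R''(r) + a⁴ R(r) ). Then ∫_0^L ∫_{r₁}^{r₁+1} u_r(z,r) u_θ(z,r) dr dz = ( L/(2a²λ₀) ) ∫_{r₁}^{r₁+1} ( R''(r) − a² R(r) )² dr, and this quantity is strictly positive. -/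
open Set in
theorem ContDiffOn.hasDerivAt_iteratedDerivWithin_Icc {f : ℝ → ℝ} {b c : ℝ} {n : ℕ∞} {k : ℕ}
    (hbc : b < c) (hf : ContDiffOn ℝ n f (Icc b c)) (hk : k < n) {x : ℝ} (hx : x ∈ Ioo b c) :
    HasDerivAt (iteratedDerivWithin k f (Icc b c)) (iteratedDerivWithin (k + 1) f (Icc b c) x) x := by
  rw [iteratedDerivWithin_succ]
  have hd := hf.differentiableOn_iteratedDerivWithin (m := k) (by exact_mod_cast hk)
    (uniqueDiffOn_Icc hbc)
  exact (hd x (Ioo_subset_Icc_self hx)).hasDerivWithinAt.hasDerivAt (Icc_mem_nhds hx.1 hx.2)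

theorem integral_cos_sq_mul_of_sin_eq_zero {a L : ℝ} (ha : a ≠ 0) (hsin : Real.sin (a * L) = 0) :
    ∫ z in (0 : ℝ)..L, Real.cos (a * z) ^ 2 = L / 2 := by
  rw [intervalIntegral.integral_comp_mul_left (fun z => Real.cos z ^ 2) ha, integral_cos_sq]
  simp [hsin]
  field_simp

open Set in
theorem integral_mul_sub_eq_integral_sq {R R₁ R₂ R₃ R₄ : ℝ → ℝ} {b c : ℝ} (a : ℝ) (hbc : b ≤ c)
    (c0 : ContinuousOn R (Icc b c)) (c1 : ContinuousOn R₁ (Icc b c))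
    (c2 : ContinuousOn R₂ (Icc b c)) (c3 : ContinuousOn R₃ (Icc b c))
    (c4 : ContinuousOn R₄ (Icc b c))
    (d0 : ∀ x ∈ Ioo b c, HasDerivAt R (R₁ x) x) (d1 : ∀ x ∈ Ioo b c, HasDerivAt R₁ (R₂ x) x)
    (d2 : ∀ x ∈ Ioo b c, HasDerivAt R₂ (R₃ x) x) (d3 : ∀ x ∈ Ioo b c, HasDerivAt R₃ (R₄ x) x)
    (hb : R b = 0) (hc : R c = 0) (hb' : R₁ b = 0) (hc' : R₁ c = 0) :
    ∫ r in b..c, R r * (R₄ r - 2 * a ^ 2 * R₂ r + a ^ 4 * R r) =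
      ∫ r in b..c, (R₂ r - a ^ 2 * R r) ^ 2 := by
  have hI : ∀ {f : ℝ → ℝ}, ContinuousOn f (Icc b c) →
      IntervalIntegrable f MeasureTheory.volume b c :=
    fun h => h.intervalIntegrable_of_Icc hbc
  rw [← sub_eq_zero, ← intervalIntegral.integral_sub (hI (by fun_prop)) (hI (by fun_prop)),
    intervalIntegral.integral_eq_sub_of_hasDerivAt_of_le hbc
      (f := fun r => R r * R₃ r - R₁ r * R₂ r) (by fun_prop) ?_ (hI (by fun_prop))]
  · simp [hb, hc, hb', hc']
  · intro x hx
    refine (((d0 x hx).mul (d3 x hx)).sub ((d1 x hx).mul (d2 x hx))).congr_deriv ?_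
    ring

open Set in
theorem integral_sq_sub_pos {R R₁ R₂ : ℝ → ℝ} {a b c : ℝ} (ha : a ≠ 0) (hbc : b < c)
    (c0 : ContinuousOn R (Icc b c)) (c1 : ContinuousOn R₁ (Icc b c))
    (c2 : ContinuousOn R₂ (Icc b c))
    (d0 : ∀ x ∈ Ioo b c, HasDerivAt R (R₁ x) x) (d1 : ∀ x ∈ Ioo b c, HasDerivAt R₁ (R₂ x) x)
    (hb : R b = 0) (hc : R c = 0) (hne : ∃ x ∈ Icc b c, R x ≠ 0) :
    0 < ∫ r in b..c, (R₂ r - a ^ 2 * R r) ^ 2 := by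
  refine intervalIntegral.integral_pos hbc (by fun_prop) (fun _ _ => sq_nonneg _) ?_
  by_contra! h
  have hzero : ∀ x ∈ Icc b c, R₂ x = a ^ 2 * R x := fun x hx =>
    sub_eq_zero.mp (pow_eq_zero_iff two_ne_zero |>.mp (le_antisymm (h x hx) (sq_nonneg _)))
  have hcont : ContinuousOn (fun r => R₁ r ^ 2 + a ^ 2 * R r ^ 2) (Icc b c) := by fun_prop
  have hpos : 0 < ∫ r in b..c, (R₁ r ^ 2 + a ^ 2 * R r ^ 2) := by
    refine intervalIntegral.integral_pos hbc hcont (fun _ _ => by positivity) ?_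
    obtain ⟨x, hx, hRx⟩ := hne
    exact ⟨x, hx, by positivity⟩
  rw [intervalIntegral.integral_eq_sub_of_hasDerivAt_of_le hbc.le
    (f := fun r => R r * R₁ r) (by fun_prop) ?_ (hcont.intervalIntegrable_of_Icc hbc.le)] at hpos
  · simp [hb, hc] at hpos
  · intro x hx
    refine ((d0 x hx).mul (d1 x hx)).congr_deriv ?_
    rw [hzero x (Ioo_subset_Icc_self hx)]
    ring


/-- The key positivity computation `⟨Bu₀, u₀⟩ = 2∫_M u_r u_θ dx > 0` in the proof of
Theorem 5.1: the double integral of `u_r u_θ` over `M = (0,L) × (r₁, r₁+1)` equals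
`(L/(2a²λ₀)) ∫ (R'' - a²R)²`, a strictly positive quantity. -/
theorem positivity_of_quadratic_form
    (L : ℝ) (hL : 0 < L) (K : ℕ) (hK : 1 ≤ K) (a lam0 r₁ : ℝ)
    (ha : a = K * Real.pi / L) (hlam : 0 < lam0)
    (R : ℝ → ℝ)
    (hR : ContDiffOn ℝ 4 R (Set.Icc r₁ (r₁ + 1)))
    (h0 : R r₁ = 0) (h1 : R (r₁ + 1) = 0)
    (h0' : derivWithin R (Set.Icc r₁ (r₁ + 1)) r₁ = 0)
    (h1' : derivWithin R (Set.Icc r₁ (r₁ + 1)) (r₁ + 1) = 0)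
    (hne : ∃ x ∈ Set.Icc r₁ (r₁ + 1), R x ≠ 0)
    (ur uθ : ℝ → ℝ → ℝ)
    (hur : ur = fun z r => -(Real.cos (a * z)) * R r)
    (huθ : uθ = fun z r => -(1 / (a ^ 2 * lam0)) * Real.cos (a * z) *
      (iteratedDerivWithin 4 R (Set.Icc r₁ (r₁ + 1)) r
        - 2 * a ^ 2 * iteratedDerivWithin 2 R (Set.Icc r₁ (r₁ + 1)) r + a ^ 4 * R r)) :
    ((∫ z in (0:ℝ)..L, ∫ r in r₁..(r₁ + 1), ur z r * uθ z r)
      = (L / (2 * a ^ 2 * lam0)) *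
        ∫ r in r₁..(r₁ + 1),
          (iteratedDerivWithin 2 R (Set.Icc r₁ (r₁ + 1)) r - a ^ 2 * R r) ^ 2) ∧
    0 < ∫ z in (0:ℝ)..L, ∫ r in r₁..(r₁ + 1), ur z r * uθ z r := by
  have hr : r₁ < r₁ + 1 := by linarith
  have hK0 : (0 : ℝ) < K := by exact_mod_cast hK
  have ha0 : 0 < a := by rw [ha]; positivity
  have hsin : Real.sin (a * L) = 0 := by
    rw [ha, div_mul_cancel₀ _ hL.ne']
    exact Real.sin_nat_mul_pi K
  have hcont : ∀ k : ℕ, k ≤ 4 →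
      ContinuousOn (iteratedDerivWithin k R (Set.Icc r₁ (r₁ + 1))) (Set.Icc r₁ (r₁ + 1)) :=
    fun k hk => hR.continuousOn_iteratedDerivWithin (by exact_mod_cast hk) (uniqueDiffOn_Icc hr)
  have hderiv : ∀ k : ℕ, k < 4 → ∀ x ∈ Set.Ioo r₁ (r₁ + 1),
      HasDerivAt (iteratedDerivWithin k R (Set.Icc r₁ (r₁ + 1)))
        (iteratedDerivWithin (k + 1) R (Set.Icc r₁ (r₁ + 1)) x) x :=
    fun k hk x hx => ContDiffOn.hasDerivAt_iteratedDerivWithin_Icc (n := 4) hr hR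
      (by exact_mod_cast hk) hx
  have c0 := hcont 0 (by norm_num)
  have d0 := hderiv 0 (by norm_num)
  rw [iteratedDerivWithin_zero] at c0 d0
  have c1 := hcont 1 (by norm_num)
  have c2 := hcont 2 (by norm_num)
  have d1 := hderiv 1 (by norm_num)
  rw [← iteratedDerivWithin_one] at h0' h1'
  have hradial := integral_mul_sub_eq_integral_sq a hr.le c0 c1 c2 (hcont 3 (by norm_num))
    (hcont 4 le_rfl) d0 d1 (hderiv 2 (by norm_num)) (hderiv 3 (by norm_num)) h0 h1 h0' h1'
  have hpos := integral_sq_sub_pos ha0.ne' hr c0 c1 c2 d0 d1 h0 h1 hne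
  have heq : (∫ z in (0:ℝ)..L, ∫ r in r₁..(r₁ + 1), ur z r * uθ z r)
      = (L / (2 * a ^ 2 * lam0)) *
        ∫ r in r₁..(r₁ + 1),
          (iteratedDerivWithin 2 R (Set.Icc r₁ (r₁ + 1)) r - a ^ 2 * R r) ^ 2 := by
    have hprod : ∀ z r, ur z r * uθ z r = Real.cos (a * z) ^ 2 * (1 / (a ^ 2 * lam0) *
        (R r * (iteratedDerivWithin 4 R (Set.Icc r₁ (r₁ + 1)) r
          - 2 * a ^ 2 * iteratedDerivWithin 2 R (Set.Icc r₁ (r₁ + 1)) r + a ^ 4 * R r))) := by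
      intro z r
      rw [hur, huθ]
      ring
    simp_rw [hprod, intervalIntegral.integral_const_mul, intervalIntegral.integral_mul_const,
      hradial, integral_cos_sq_mul_of_sin_eq_zero ha0.ne' hsin]
    ring
  refine ⟨heq, ?_⟩
  rw [heq]
  positivity
end
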